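/- Let N ≥ 1 be an integer and take d = N and ψ(λ, ν) := |λ · ν| for λ ∈ ℝ^N, ν ∈ S^{N−1}. Then for every M ∈ ℝ^{N×N}, Φ(M) = |tr M|. In particular, for every λ ∈ ℝ^N and ν ∈ S^{N−1}, Φ(λ⊗ν) = |λ·ν| = ψ(λ, ν). -/

import Mathlib

open scoped BigOperators ENNReal

/-- The dyadic (tensor) product `λ⊗ν`, an `N × N` real matrix with entries `λ_i ν_j`. -/
def outer {N : ℕ} (l v : EuclideanSpace ℝ (Fin N)) : Matrix (Fin N) (Fin N) ℝ :=
  Matrix.of fun i j => l i * v j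

/-- The function `Φ(M) := inf { Σᵢ ψ(λᵢ,νᵢ) : Σᵢ λᵢ⊗νᵢ = M, ‖νᵢ‖ = 1 }`,
with values in `[0,+∞]`. -/
noncomputable def Phi {N : ℕ}
    (ψ : EuclideanSpace ℝ (Fin N) → EuclideanSpace ℝ (Fin N) → ℝ)
    (M : Matrix (Fin N) (Fin N) ℝ) : ℝ≥0∞ :=
  sInf { x : ℝ≥0∞ | ∃ (m : ℕ) (l : Fin m → EuclideanSpace ℝ (Fin N))
    (v : Fin m → EuclideanSpace ℝ (Fin N)),
    (∀ i, ‖v i‖ = 1) ∧ (∑ i, outer (l i) (v i)) = M ∧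
    x = ENNReal.ofReal (∑ i, ψ (l i) (v i)) }

section RankOneDecomposition

variable {N : ℕ}

lemma trace_outer (l v : EuclideanSpace ℝ (Fin N)) :
    Matrix.trace (outer l v) = ∑ j, l j * v j := rfl

lemma outer_smul_smul_inv (l v : EuclideanSpace ℝ (Fin N)) {c : ℝ} (hc : c ≠ 0) :
    outer (c • l) (c⁻¹ • v) = outer l v := by
  ext i j
  simp only [outer, Matrix.of_apply, PiLp.smul_apply, smul_eq_mul]
  field_simp

/-- `Φ` is subadditive: concatenate the two decompositions. -/
lemma Phi_add_le {ψ : EuclideanSpace ℝ (Fin N) → EuclideanSpace ℝ (Fin N) → ℝ}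
    (A B : Matrix (Fin N) (Fin N) ℝ) : Phi ψ (A + B) ≤ Phi ψ A + Phi ψ B := by
  conv_rhs => unfold Phi
  rw [ENNReal.sInf_add]
  refine le_iInf₂ fun x hx => ?_
  rw [ENNReal.add_sInf]
  refine le_iInf₂ fun y hy => ?_
  obtain ⟨m, l, v, hv, rfl, rfl⟩ := hx
  obtain ⟨n, k, w, hw, rfl, rfl⟩ := hy
  refine le_trans (sInf_le ⟨m + n, Fin.append l k, Fin.append v w, ?_, ?_, rfl⟩) ?_
  · intro i
    refine Fin.addCases (fun i => ?_) (fun i => ?_) i <;> simp [hv, hw]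
  · simp [Fin.sum_univ_add]
  · simp only [Fin.sum_univ_add, Fin.append_left, Fin.append_right]
    exact ENNReal.ofReal_add_le

lemma Phi_zero (ψ : EuclideanSpace ℝ (Fin N) → EuclideanSpace ℝ (Fin N) → ℝ) :
    Phi ψ 0 = 0 :=
  nonpos_iff_eq_zero.1 <| sInf_le ⟨0, Fin.elim0, Fin.elim0, fun i => i.elim0, by simp, by simp⟩

lemma Phi_sum_le (ψ : EuclideanSpace ℝ (Fin N) → EuclideanSpace ℝ (Fin N) → ℝ)
    {ι : Type*} (s : Finset ι) (A : ι → Matrix (Fin N) (Fin N) ℝ) :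
    Phi ψ (∑ i ∈ s, A i) ≤ ∑ i ∈ s, Phi ψ (A i) :=
  Finset.le_sum_of_subadditive (Phi ψ) (Phi_zero ψ).le Phi_add_le s A

/-- The interfacial density `ψ₀(λ,ν) = |λ·ν|`. -/
def absDot (l v : EuclideanSpace ℝ (Fin N)) : ℝ := |∑ j, l j * v j|

lemma Phi_absDot_outer_le (l v : EuclideanSpace ℝ (Fin N)) :
    Phi absDot (outer l v) ≤ ENNReal.ofReal |Matrix.trace (outer l v)| := by
  rcases eq_or_ne v 0 with rfl | hv
  · have h : outer l 0 = 0 := by ext; simp [outer]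
    simp [h, Phi_zero]
  · have hv' : ‖v‖ ≠ 0 := norm_ne_zero_iff.2 hv
    rw [← outer_smul_smul_inv l v hv']
    exact sInf_le ⟨1, fun _ => ‖v‖ • l, fun _ => ‖v‖⁻¹ • v,
      fun _ => by simp [norm_smul, hv'], by simp, by simp [absDot, trace_outer]⟩

lemma abs_trace_le_Phi_absDot (M : Matrix (Fin N) (Fin N) ℝ) :
    ENNReal.ofReal |Matrix.trace M| ≤ Phi absDot M := by
  refine le_sInf ?_
  rintro _ ⟨m, l, v, -, rfl, rfl⟩
  refine ENNReal.ofReal_le_ofReal ?_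
  rw [Matrix.trace_sum]
  exact Finset.abs_sum_le_sum_abs _ _

lemma outer_single_single (i j : Fin N) (a b : ℝ) :
    outer (EuclideanSpace.single i a) (EuclideanSpace.single j b) = Matrix.single i j (a * b) := by
  ext p q
  by_cases hp : i = p <;> by_cases hq : j = q <;>
    simp [outer, @eq_comm _ p i, @eq_comm _ q j, hp, hq]

lemma Phi_absDot_single_le (i j : Fin N) (c : ℝ) :
    Phi absDot (Matrix.single i j c) ≤ ENNReal.ofReal |Matrix.trace (Matrix.single i j c)| := by
  simpa [outer_single_single] using
    Phi_absDot_outer_le (EuclideanSpace.single i c) (EuclideanSpace.single j 1)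

lemma Phi_absDot_single_of_ne {i j : Fin N} (h : i ≠ j) (c : ℝ) :
    Phi absDot (Matrix.single i j c) = 0 := by
  simpa [Matrix.trace_single_eq_of_ne, h] using Phi_absDot_single_le i j c

lemma Phi_absDot_single_sub_single (i j : Fin N) (c : ℝ) :
    Phi absDot (Matrix.single i i c - Matrix.single j j c) = 0 := by
  rcases eq_or_ne i j with rfl | h
  · simp [Phi_zero]
  set D := outer (EuclideanSpace.single i c + EuclideanSpace.single j c)
    (EuclideanSpace.single i 1 - EuclideanSpace.single j 1) with hD
  have expand : D = Matrix.single i i c - Matrix.single i j c + Matrix.single j i c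
      - Matrix.single j j c := by
    have h₁ := outer_single_single i i c 1
    have h₂ := outer_single_single i j c 1
    have h₃ := outer_single_single j i c 1
    have h₄ := outer_single_single j j c 1
    rw [mul_one] at h₁ h₂ h₃ h₄
    rw [hD, ← h₁, ← h₂, ← h₃, ← h₄]
    ext p q
    simp only [outer, Matrix.of_apply, PiLp.add_apply, PiLp.sub_apply, Matrix.add_apply,
      Matrix.sub_apply]
    ring
  have trace_D : Matrix.trace D = 0 := by
    simp [expand, Matrix.trace_single_eq_of_ne, h, h.symm]
  have hD₀ : Phi absDot D = 0 := by
    have h_le : Phi absDot D ≤ ENNReal.ofReal |Matrix.trace D| := Phi_absDot_outer_le _ _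
    simpa [trace_D] using h_le
  have split : Matrix.single i i c - Matrix.single j j c
      = D + (Matrix.single i j c + Matrix.single j i (-c)) := by
    rw [expand, ← Matrix.single_neg]
    abel
  rw [split, ← nonpos_iff_eq_zero]
  calc _ ≤ _ := (Phi_add_le _ _).trans (add_le_add_right (Phi_add_le _ _) _)
    _ = 0 := by simp [hD₀, Phi_absDot_single_of_ne, h, h.symm]

lemma Phi_absDot_le (M : Matrix (Fin N) (Fin N) ℝ) (k : Fin N) :
    Phi absDot M ≤ ENNReal.ofReal |Matrix.trace M| := by
  have split : M = (∑ i, ∑ j, (Matrix.single i j (M i j)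
      - if i = j then Matrix.single k k (M i j) else 0)) + Matrix.single k k (Matrix.trace M) := by
    conv_lhs => rw [Matrix.matrix_eq_sum_single M]
    have h : Matrix.single k k (Matrix.trace M) = ∑ i, Matrix.single k k (M i i) :=
      map_sum (Matrix.singleAddMonoidHom k k) _ _
    simp [Finset.sum_sub_distrib, h]
  have term (i j : Fin N) : Phi absDot (Matrix.single i j (M i j)
      - if i = j then Matrix.single k k (M i j) else 0) = 0 := by
    split_ifs with h
    · subst h
      exact Phi_absDot_single_sub_single i k _
    · rw [sub_zero, Phi_absDot_single_of_ne h]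
  have sum_zero : Phi absDot (∑ i, ∑ j, (Matrix.single i j (M i j)
      - if i = j then Matrix.single k k (M i j) else 0)) = 0 := by
    rw [← nonpos_iff_eq_zero]
    refine (Phi_sum_le _ _ _).trans ?_
    refine (Finset.sum_le_sum fun i _ => Phi_sum_le _ _ _).trans ?_
    simp [term]
  rw [split]
  refine (Phi_add_le _ _).trans ?_
  rw [sum_zero, zero_add, ← split]
  simpa using Phi_absDot_single_le k k (Matrix.trace M)

lemma Phi_absDot (hN : 1 ≤ N) (M : Matrix (Fin N) (Fin N) ℝ) :
    Phi absDot M = ENNReal.ofReal |Matrix.trace M| :=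
  (Phi_absDot_le M ⟨0, hN⟩).antisymm (abs_trace_le_Phi_absDot M)

end RankOneDecomposition

/-- The explicit example of Section 3.3: for `ψ(λ,ν) = |λ·ν|`, one has `Φ(M) = |tr M|`
for every `M`; in particular `Φ(λ⊗ν) = |λ·ν| = ψ(λ,ν)` for unit `ν`. -/
theorem stmt12 (N : ℕ) (hN : 1 ≤ N)
    (ψ : EuclideanSpace ℝ (Fin N) → EuclideanSpace ℝ (Fin N) → ℝ)
    (hψ : ∀ l v : EuclideanSpace ℝ (Fin N), ψ l v = |∑ j, l j * v j|) :
    (∀ M : Matrix (Fin N) (Fin N) ℝ, Phi ψ M = ENNReal.ofReal |Matrix.trace M|) ∧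
    (∀ l v : EuclideanSpace ℝ (Fin N), ‖v‖ = 1 →
      Phi ψ (outer l v) = ENNReal.ofReal |∑ j, l j * v j|) := by
  obtain rfl : ψ = absDot := funext₂ hψ
  exact ⟨Phi_absDot hN, fun l v _ => Phi_absDot hN (outer l v)⟩
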